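/- arXiv:2205.08312 — 4 statements merged into one kernel-verified Lean document; each statement's English description precedes it below -/
import Mathlib

section
/- (Theorem for A₁ quiver, Kirillov–Reshetikhin specialization.) Let w ≥ 1 be a natural number, let q₁, q₂ be nonzero complex numbers satisfying the genericity conditions q₁^k ≠ 1, q₂ ≠ q₁^k and q₁^k q₂ ≠ 1 for all integers k with 0 < |k| ≤ w, let x be a nonzero complex number, let K be a commutative ring with a ℂ-algebra structure φ : ℂ → K, and let Y : ℂ → Kˣ be an arbitrary function. Then, writing x_α = x q₁^{α−1} for α = 1, …, w, ∑_{I ⊔ J = {1,…,w}} ∏_{i∈I, j∈J} φ(𝒮(q₁^{i−j})) · ∏_{i∈I} Y(x q₁^{i−1}) · ∏_{j∈J} Y(x q₁^{j} q₂)⁻¹ = ∑_{v=0}^{w} ( ∏_{i=1}^{w−v} ∏_{j=1}^{v} φ(𝒮(q₁^{1−i−j})) ) · ∏_{i=1}^{w−v} Y(x q₁^{i−1}) · ∏_{j=w−v+1}^{w} Y(x q₁^{j} q₂)⁻¹, where the left-hand sum runs over all 2^w ordered partitions of {1,…,w} into disjoint subsets I and J. That is, under the specialization x_α = x q₁^{α−1}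 the 2^w-term weight-w qq-character of A₁ quiver reduces to the (w+1)-term irreducible qq-character of the Kirillov–Reshetikhin module. -/
open Finset

/-- The 𝒮-function of the qq-character formalism:
`𝒮(z) = ((1 − z/q₁)(1 − z/q₂)) / ((1 − z)(1 − z/(q₁q₂)))`. -/
noncomputable def Sfun (q₁ q₂ z : ℂ) : ℂ :=
  ((1 - z / q₁) * (1 - z / q₂)) / ((1 - z) * (1 - z / (q₁ * q₂)))

theorem Sfun_self {q₁ : ℂ} (q₂ : ℂ) (hq₁ : q₁ ≠ 0) : Sfun q₁ q₂ q₁ = 0 := by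
  simp [Sfun, hq₁]

theorem Finset.eq_Icc_one_sup_of_pred_mem {w : ℕ} {I : Finset ℕ} (hI : I ⊆ Finset.Icc 1 w)
    (hpred : ∀ i ∈ I, 2 ≤ i → i - 1 ∈ I) : I = Finset.Icc 1 (I.sup id) := by
  have hlower : ∀ d, ∀ i ∈ I, d < i → i - d ∈ I := by
    intro d
    induction d with
    | zero => intro i hi _; exact hi
    | succ d ih =>
      intro i hi hd
      exact hpred _ (ih i hi (by lia)) (by lia)
  ext k
  rw [Finset.mem_Icc]
  constructor
  · intro hk
    exact ⟨(Finset.mem_Icc.1 (hI hk)).1, Finset.le_sup (f := id) hk⟩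
  · rintro ⟨hk, hkm⟩
    have hne : I.Nonempty := by
      rw [Finset.nonempty_iff_ne_empty]
      rintro rfl
      simp at hkm
      lia
    obtain ⟨m, hm, hsup⟩ := Finset.exists_mem_eq_sup I hne id
    rw [hsup, id] at hkm
    have h := hlower (m - k) m hm (by lia)
    rwa [Nat.sub_sub_self hkm] at h

theorem Finset.prod_Icc_one_prod_Icc_add {M : Type*} [CommMonoid M] (f : ℤ → M) (m v : ℕ) :
    ∏ i ∈ Finset.Icc 1 m, ∏ j ∈ Finset.Icc (m + 1) (m + v), f ((i : ℤ) - (j : ℤ)) =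
      ∏ i ∈ Finset.Icc 1 m, ∏ j ∈ Finset.Icc 1 v, f (1 - (i : ℤ) - (j : ℤ)) := by
  refine Finset.prod_nbij' (fun i => m + 1 - i) (fun i => m + 1 - i) ?_ ?_ ?_ ?_ ?_
  · intro i hi; simp only [Finset.mem_Icc] at *; lia
  · intro i hi; simp only [Finset.mem_Icc] at *; lia
  · intro i hi; simp only [Finset.mem_Icc] at *; lia
  · intro i hi; simp only [Finset.mem_Icc] at *; lia
  · intro i hi
    refine Finset.prod_nbij' (fun j => j - m) (fun j => j + m) ?_ ?_ ?_ ?_ ?_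
    · intro j hj; simp only [Finset.mem_Icc] at *; lia
    · intro j hj; simp only [Finset.mem_Icc] at *; lia
    · intro j hj; simp only [Finset.mem_Icc] at *; lia
    · intro j hj; simp only [Finset.mem_Icc] at *; lia
    · intro j hj
      simp only [Finset.mem_Icc] at *
      congr 1
      lia

/-- A₁ quiver, Kirillov–Reshetikhin specialization: under the specialization
`x_α = x q₁^{α−1}` the `2^w`-term weight-`w` qq-character of the A₁ quiver
reduces to the `(w+1)`-term irreducible qq-character of the KR module. -/
theorem A1_KR_specialization (w : ℕ) (hw : 1 ≤ w) (q₁ q₂ : ℂ)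
    (hq₁ : q₁ ≠ 0) (hq₂ : q₂ ≠ 0)
    (hgen : ∀ k : ℤ, k ≠ 0 → k.natAbs ≤ w →
      q₁ ^ k ≠ 1 ∧ q₂ ≠ q₁ ^ k ∧ q₁ ^ k * q₂ ≠ 1)
    (x : ℂ) (hx : x ≠ 0)
    (K : Type*) [CommRing K] [Algebra ℂ K] (Y : ℂ → Kˣ) :
    ∑ I ∈ (Finset.Icc 1 w).powerset,
      (∏ i ∈ I, ∏ j ∈ Finset.Icc 1 w \ I,
          algebraMap ℂ K (Sfun q₁ q₂ (q₁ ^ ((i : ℤ) - (j : ℤ))))) *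
        (((∏ i ∈ I, Y (x * q₁ ^ (i - 1))) *
          ∏ j ∈ Finset.Icc 1 w \ I, (Y (x * q₁ ^ j * q₂))⁻¹ : Kˣ) : K)
    = ∑ v ∈ Finset.range (w + 1),
      (∏ i ∈ Finset.Icc 1 (w - v), ∏ j ∈ Finset.Icc 1 v,
          algebraMap ℂ K (Sfun q₁ q₂ (q₁ ^ (1 - (i : ℤ) - (j : ℤ))))) *
        (((∏ i ∈ Finset.Icc 1 (w - v), Y (x * q₁ ^ (i - 1))) *
          ∏ j ∈ Finset.Icc (w - v + 1) w, (Y (x * q₁ ^ j * q₂))⁻¹ : Kˣ) : K) := by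
  symm
  refine Finset.sum_of_injOn (fun v => Finset.Icc 1 (w - v)) ?_ ?_ ?_ ?_
  · intro a ha b hb hab
    have h := congrArg Finset.card hab
    simp only [Finset.coe_range, Set.mem_Iio, Nat.card_Icc] at ha hb h
    lia
  · intro v _
    rw [Finset.mem_coe, Finset.mem_powerset]
    exact Finset.Icc_subset_Icc_right (Nat.sub_le w v)
  · intro I hI hnot
    rw [Finset.mem_powerset] at hI
    obtain ⟨i, hi, hi2, hpred⟩ : ∃ i ∈ I, 2 ≤ i ∧ i - 1 ∉ I := by
      by_contra! hpred
      have hsup : I.sup id ≤ w := Finset.sup_le fun i hi => (Finset.mem_Icc.1 (hI hi)).2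
      refine hnot ⟨w - I.sup id, by simp, ?_⟩
      dsimp only
      rw [Nat.sub_sub_self hsup]
      exact (Finset.eq_Icc_one_sup_of_pred_mem hI hpred).symm
    have hiw := Finset.mem_Icc.1 (hI hi)
    have hmem : i - 1 ∈ Finset.Icc 1 w \ I :=
      Finset.mem_sdiff.2 ⟨Finset.mem_Icc.2 (by lia), hpred⟩
    have hexp : (i : ℤ) - ((i - 1 : ℕ) : ℤ) = 1 := by lia
    have hzero : algebraMap ℂ K (Sfun q₁ q₂ (q₁ ^ ((i : ℤ) - ((i - 1 : ℕ) : ℤ)))) = 0 := by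
      rw [hexp, zpow_one, Sfun_self q₂ hq₁, map_zero]
    rw [Finset.prod_eq_zero hi (Finset.prod_eq_zero hmem hzero), zero_mul]
  · intro v hv
    have hvw : v ≤ w := by simpa [Nat.lt_succ_iff] using hv
    have hcompl : Finset.Icc 1 w \ Finset.Icc 1 (w - v) = Finset.Icc (w - v + 1) w := by
      ext k
      simp only [Finset.mem_sdiff, Finset.mem_Icc]
      lia
    have hprod := Finset.prod_Icc_one_prod_Icc_add
      (fun k : ℤ => algebraMap ℂ K (Sfun q₁ q₂ (q₁ ^ k))) (w - v) v
    rw [Nat.sub_add_cancel hvw] at hprod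
    rw [hcompl, hprod]
end

section
/- (Selection lemma for the A₁ Kirillov–Reshetikhin specialization.) Let w ≥ 1 be a natural number and let q₁, q₂ be nonzero complex numbers satisfying q₁^k ≠ 1, q₂ ≠ q₁^k and q₁^k q₂ ≠ 1 for all integers k with 0 < |k| ≤ w. Let I ⊆ {1,…,w} and let J be its complement. Then ∏_{i∈I, j∈J} 𝒮(q₁^{i−j}) ≠ 0 if and only if I = {1, …, |I|} (equivalently, J = {w−|J|+1, …, w}). -/
open Finset

theorem Sfun_ne_zero_iff {q₁ q₂ z : ℂ} :
    Sfun q₁ q₂ z ≠ 0 ↔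
      (1 - z / q₁ ≠ 0 ∧ 1 - z / q₂ ≠ 0) ∧ 1 - z ≠ 0 ∧ 1 - z / (q₁ * q₂) ≠ 0 := by
  simp only [Sfun, div_ne_zero_iff, mul_ne_zero_iff]

theorem Sfun_zpow_ne_zero_iff {w : ℕ} {q₁ q₂ : ℂ} (hq₁ : q₁ ≠ 0) (hq₂ : q₂ ≠ 0)
    (hgen : ∀ k : ℤ, k ≠ 0 → k.natAbs ≤ w → q₁ ^ k ≠ 1 ∧ q₂ ≠ q₁ ^ k)
    {k : ℤ} (hk : k ≠ 0) (hkw : k.natAbs < w) :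
    Sfun q₁ q₂ (q₁ ^ k) ≠ 0 ↔ k ≠ 1 := by
  rw [Sfun_ne_zero_iff]
  refine ⟨?_, fun hk1 => ?_⟩
  · rintro ⟨⟨h, -⟩, -⟩ rfl
    simp [hq₁] at h
  · obtain ⟨h₁, h₂⟩ := hgen k hk hkw.le
    obtain ⟨h₃, h₄⟩ := hgen (k - 1) (by lia) (by lia)
    rw [← div_div, show q₁ ^ k / q₁ = q₁ ^ (k - 1) from (zpow_sub_one₀ hq₁ k).symm]
    simp only [sub_ne_zero, ne_eq, eq_comm (a := (1 : ℂ)), div_eq_one_iff_eq hq₂]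
    exact ⟨⟨h₃, h₂.symm⟩, h₁, h₄.symm⟩

theorem Finset.eq_Icc_one_card_iff {w : ℕ} {I : Finset ℕ} (hI : I ⊆ Finset.Icc 1 w) :
    I = Finset.Icc 1 I.card ↔ ∀ i ∈ I, ∀ j ∈ Finset.Icc 1 w \ I, i ≠ j + 1 := by
  constructor
  · intro h i hi j hj hij
    rw [h, Finset.mem_Icc] at hi
    rw [Finset.mem_sdiff, Finset.mem_Icc] at hj
    refine hj.2 ?_
    rw [h, Finset.mem_Icc]
    lia
  · intro h
    have initial : ∀ i ∈ I, Finset.Icc 1 i ⊆ I := by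
      intro i
      induction i with
      | zero => simp
      | succ n ih =>
        intro hn j hj
        have hnw := Finset.mem_Icc.1 (hI hn)
        rw [Finset.mem_Icc] at hj
        rcases hj.2.eq_or_lt with rfl | hlt
        · exact hn
        · have hnI : n ∈ I := by
            by_contra hnI
            exact h _ hn n (Finset.mem_sdiff.2 ⟨Finset.mem_Icc.2 (by lia), hnI⟩) rfl
          exact ih hnI (Finset.mem_Icc.2 (by lia))
    refine Finset.eq_of_subset_of_card_le (fun i hi => ?_) (by simp)
    have hcard := Finset.card_le_card (initial i hi)
    rw [Nat.card_Icc] at hcard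
    exact Finset.mem_Icc.2 ⟨(Finset.mem_Icc.1 (hI hi)).1, by lia⟩

/-- Selection lemma for the A₁ Kirillov–Reshetikhin specialization: for
`I ⊆ {1,…,w}` with complement `J`, the coefficient `∏_{i∈I, j∈J} 𝒮(q₁^{i−j})`
is nonzero iff `I` is an initial segment `{1, …, |I|}`. -/
theorem A1_KR_selection (w : ℕ) (hw : 1 ≤ w) (q₁ q₂ : ℂ)
    (hq₁ : q₁ ≠ 0) (hq₂ : q₂ ≠ 0)
    (hgen : ∀ k : ℤ, k ≠ 0 → k.natAbs ≤ w →
      q₁ ^ k ≠ 1 ∧ q₂ ≠ q₁ ^ k ∧ q₁ ^ k * q₂ ≠ 1)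
    (I : Finset ℕ) (hI : I ⊆ Finset.Icc 1 w) :
    (∏ i ∈ I, ∏ j ∈ Finset.Icc 1 w \ I,
        Sfun q₁ q₂ (q₁ ^ ((i : ℤ) - (j : ℤ)))) ≠ 0 ↔
      I = Finset.Icc 1 I.card := by
  rw [Finset.eq_Icc_one_card_iff hI]
  simp only [Finset.prod_ne_zero_iff]
  refine forall₂_congr fun i hi => forall₂_congr fun j hj => ?_
  have hi' := Finset.mem_Icc.1 (hI hi)
  obtain ⟨hjw, hjI⟩ := Finset.mem_sdiff.1 hj
  rw [Finset.mem_Icc] at hjw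
  have hij : i ≠ j := fun h => hjI (h ▸ hi)
  rw [Sfun_zpow_ne_zero_iff hq₁ hq₂
    (fun k hk hkw => ⟨(hgen k hk hkw).1, (hgen k hk hkw).2.1⟩) (by lia) (by lia)]
  lia
end

section
/- Let w ≥ 1 be a natural number, 0 ≤ v ≤ w, and set m = min(v, w−v) and M = max(v, w−v). Let q₁, q₂ be nonzero complex numbers with q₁^k ≠ 1 for all 1 ≤ k ≤ w and q₁^k q₂ ≠ 1 for all 2 ≤ k ≤ w. Then the coefficient of the irreducible weight-w qq-character of A₁ quiver evaluates in closed form as ∏_{i=1}^{w−v} ∏_{j=1}^{v} 𝒮(q₁^{1−i−j}) = ∏_{k=1}^{m} [ (1 − q₁^{−M−k})(1 − q₁^{−k} q₂^{−1}) ] / [ (1 − q₁^{−k})(1 − q₁^{−M−k} q₂^{−1}) ]. -/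
open Finset

theorem prod_Icc_ratio_telescope {K : Type*} [Field K] (A B : ℕ → K) (i M : ℕ)
    (hA : ∀ n, i ≤ n → n ≤ i + M → A n ≠ 0)
    (hB : ∀ n, i < n → n ≤ i + M → B n ≠ 0) :
    ∏ j ∈ Finset.Icc 1 (M + 1),
        (A (i + j) * B (i + j - 1)) / (A (i + j - 1) * B (i + j))
      = (A (i + (M + 1)) * B i) / (A i * B (i + (M + 1))) := by
  induction M with
  | zero => simp
  | succ M ih =>
    rw [Finset.prod_Icc_succ_top (by omega),
      ih (fun n h h' => hA n h (by omega)) (fun n h h' => hB n h (by omega))]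
    have hA' := hA (i + (M + 1)) (by omega) le_rfl
    have hB' := hB (i + (M + 1)) (by omega) le_rfl
    rw [show i + (M + 1 + 1) - 1 = i + (M + 1) by omega, div_mul_div_comm,
      show A (i + (M + 1)) * B i * (A (i + (M + 1 + 1)) * B (i + (M + 1)))
        = (A (i + (M + 1 + 1)) * B i) * (A (i + (M + 1)) * B (i + (M + 1))) by ring,
      show A i * B (i + (M + 1)) * (A (i + (M + 1)) * B (i + (M + 1 + 1)))
        = (A i * B (i + (M + 1 + 1))) * (A (i + (M + 1)) * B (i + (M + 1))) by ring,
      mul_div_mul_right _ _ (mul_ne_zero hA' hB')]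

theorem Sfun_zpow (q₁ q₂ : ℂ) (hq₁ : q₁ ≠ 0) (n : ℕ) (hn : 1 ≤ n) :
    Sfun q₁ q₂ (q₁ ^ (1 - (n : ℤ)))
      = ((1 - q₁ ^ (-(n : ℤ))) * (1 - q₁ ^ (-((n - 1 : ℕ) : ℤ)) * q₂⁻¹)) /
        ((1 - q₁ ^ (-((n - 1 : ℕ) : ℤ))) * (1 - q₁ ^ (-(n : ℤ)) * q₂⁻¹)) := by
  have e : (1 - (n : ℤ)) = -((n - 1 : ℕ) : ℤ) := by omega
  have e' : q₁ ^ (1 - (n : ℤ)) / q₁ = q₁ ^ (-(n : ℤ)) := by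
    rw [div_eq_mul_inv, ← zpow_sub_one₀ hq₁]
    congr 1
    ring
  rw [Sfun, ← div_div _ q₁ q₂, e', e, div_eq_mul_inv _ q₂, div_eq_mul_inv _ q₂]

theorem prod_Sfun_zpow (q₁ q₂ : ℂ) (hq₁ : q₁ ≠ 0) (m M : ℕ) (hM : 1 ≤ M)
    (h1 : ∀ k : ℕ, 1 ≤ k → k ≤ m + M → q₁ ^ k ≠ 1)
    (h2 : ∀ k : ℕ, 2 ≤ k → k ≤ m + M → q₁ ^ k * q₂ ≠ 1) :
    ∏ i ∈ Finset.Icc 1 m, ∏ j ∈ Finset.Icc 1 M,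
        Sfun q₁ q₂ (q₁ ^ (1 - (i : ℤ) - (j : ℤ)))
      = ∏ k ∈ Finset.Icc 1 m,
          ((1 - q₁ ^ (-(M : ℤ) - (k : ℤ))) * (1 - q₁ ^ (-(k : ℤ)) * q₂⁻¹)) /
            ((1 - q₁ ^ (-(k : ℤ))) * (1 - q₁ ^ (-(M : ℤ) - (k : ℤ)) * q₂⁻¹)) := by
  refine Finset.prod_congr rfl fun i hi => ?_
  rw [Finset.mem_Icc] at hi
  obtain ⟨N, rfl⟩ : ∃ N, M = N + 1 := ⟨M - 1, by omega⟩
  have key := prod_Icc_ratio_telescope (fun n : ℕ => 1 - q₁ ^ (-(n : ℤ)))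
    (fun n : ℕ => 1 - q₁ ^ (-(n : ℤ)) * q₂⁻¹) i N
    (fun n hn hn' h => h1 n (by omega) (by omega) (by
      rw [zpow_neg, zpow_natCast] at h
      exact inv_eq_one.mp (sub_eq_zero.mp h).symm))
    (fun n hn hn' h => h2 n (by omega) (by omega) (by
      rw [zpow_neg, zpow_natCast, ← mul_inv] at h
      exact inv_eq_one.mp (sub_eq_zero.mp h).symm))
  have e : -((N + 1 : ℕ) : ℤ) - (i : ℤ) = -((i + (N + 1) : ℕ) : ℤ) := by push_cast; ring
  rw [e, ← key]
  refine Finset.prod_congr rfl fun j hj => ?_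
  rw [← Sfun_zpow q₁ q₂ hq₁ (i + j) (by omega)]
  congr 2
  push_cast
  ring

/-- Closed form of the coefficient of the irreducible weight-`w` qq-character
of the A₁ quiver: with `m = min(v, w−v)` and `M = max(v, w−v)`,
`∏_{i=1}^{w−v} ∏_{j=1}^{v} 𝒮(q₁^{1−i−j})
  = ∏_{k=1}^{m} ((1 − q₁^{−M−k})(1 − q₁^{−k}q₂^{−1})) /
      ((1 − q₁^{−k})(1 − q₁^{−M−k}q₂^{−1}))`. -/
theorem A1_coefficient_closed_form (w v : ℕ) (hw : 1 ≤ w) (hv : v ≤ w)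
    (q₁ q₂ : ℂ) (hq₁ : q₁ ≠ 0) (hq₂ : q₂ ≠ 0)
    (h1 : ∀ k : ℕ, 1 ≤ k → k ≤ w → q₁ ^ k ≠ 1)
    (h2 : ∀ k : ℕ, 2 ≤ k → k ≤ w → q₁ ^ k * q₂ ≠ 1) :
    ∏ i ∈ Finset.Icc 1 (w - v), ∏ j ∈ Finset.Icc 1 v,
        Sfun q₁ q₂ (q₁ ^ (1 - (i : ℤ) - (j : ℤ)))
      = ∏ k ∈ Finset.Icc 1 (min v (w - v)),
          ((1 - q₁ ^ (-(max v (w - v) : ℤ) - (k : ℤ))) *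
              (1 - q₁ ^ (-(k : ℤ)) * q₂⁻¹)) /
            ((1 - q₁ ^ (-(k : ℤ))) *
              (1 - q₁ ^ (-(max v (w - v) : ℤ) - (k : ℤ)) * q₂⁻¹)) := by
  have hc : ((w : ℤ) - (v : ℤ)) = ((w - v : ℕ) : ℤ) := by omega
  rw [hc]
  rcases le_total v (w - v) with h | h
  · rw [min_eq_left h, max_eq_right (by exact_mod_cast h), Finset.prod_comm,
      ← prod_Sfun_zpow q₁ q₂ hq₁ v (w - v) (by omega)
        (fun k hk hk' => h1 k hk (by omega)) (fun k hk hk' => h2 k hk (by omega))]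
    refine Finset.prod_congr rfl fun i _ => Finset.prod_congr rfl fun j _ => ?_
    rw [sub_right_comm]
  · rw [min_eq_right h, max_eq_left (by exact_mod_cast h),
      ← prod_Sfun_zpow q₁ q₂ hq₁ (w - v) v (by omega)
        (fun k hk hk' => h1 k hk (by omega)) (fun k hk hk' => h2 k hk (by omega))]
end

section
/- (Classical limit q₁ → 1 of the irreducible A₁ qq-character coefficients.) Let w ≥ 1 be a natural number, 0 ≤ v ≤ w, and fix a nonzero complex number q₂ with q₂ ≠ 1. Then the function q₁ ↦ ∏_{i=1}^{w−v} ∏_{j=1}^{v} 𝒮(q₁^{1−i−j}) tends to the binomial coefficient C(w, v) as q₁ → 1 within ℂ \ {1}. Consequently, in the limit q₁ → 1 the irreducible weight-w qq-character of A₁ quiver degenerates to the w-th power (𝖸_x + 𝖸_{x q₂}^{−1})^w of the fundamental q-character. -/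
open Finset Filter Topology

/-- The ratio of `q ^ a - 1` and `q ^ b - 1` tends to `a / b` as `q → 1`. -/
theorem tendsto_zpow_sub_one_div (a b : ℤ) (hb : b ≠ 0) :
    Tendsto (fun q : ℂ => (q ^ a - 1) / (q ^ b - 1)) (𝓝[≠] 1) (𝓝 ((a : ℂ) / b)) := by
  have slope_tendsto (n : ℤ) :
      Tendsto (slope (fun q : ℂ => q ^ n) 1) (𝓝[≠] 1) (𝓝 (n : ℂ)) := by
    simpa using (hasDerivAt_zpow n (1 : ℂ) (Or.inl one_ne_zero)).tendsto_slope
  refine ((slope_tendsto a).div (slope_tendsto b) (by exact_mod_cast hb)).congr' ?_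
  filter_upwards [self_mem_nhdsWithin] with q hq
  have hq1 : q - 1 ≠ 0 := sub_ne_zero.mpr hq
  simp only [Pi.div_apply, slope_def_field, one_zpow]
  exact div_div_div_cancel_right₀ hq1 _ _

theorem tendsto_Sfun_zpow (q₂ : ℂ) (hq₂ : q₂ ≠ 0) (hq₂1 : q₂ ≠ 1) (a : ℤ) (ha : a ≠ 0) :
    Tendsto (fun q : ℂ => Sfun q q₂ (q ^ a)) (𝓝[≠] 1) (𝓝 (((a - 1 : ℤ) : ℂ) / a)) := by
  have hz : Tendsto (fun q : ℂ => q ^ a) (𝓝[≠] 1) (𝓝 1) := by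
    simpa using (continuousAt_zpow₀ (1 : ℂ) a (Or.inl one_ne_zero)).tendsto.mono_left
      nhdsWithin_le_nhds
  have hid : Tendsto (fun q : ℂ => q) (𝓝[≠] 1) (𝓝 1) := tendsto_id.mono_left nhdsWithin_le_nhds
  have hne : 1 - 1 / q₂ ≠ 0 := by
    rw [sub_ne_zero, ne_eq, eq_div_iff hq₂, one_mul]
    exact hq₂1
  have hnum : Tendsto (fun q : ℂ => 1 - q ^ a / q₂) (𝓝[≠] 1) (𝓝 (1 - 1 / q₂)) :=
    (hz.div_const q₂).const_sub 1
  have hden : Tendsto (fun q : ℂ => 1 - q ^ a / (q * q₂)) (𝓝[≠] 1) (𝓝 (1 - 1 / q₂)) := by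
    simpa using (hz.div (hid.mul_const q₂) (by simpa using hq₂)).const_sub 1
  have h := (tendsto_zpow_sub_one_div (a - 1) a ha).mul (hnum.div hden hne)
  rw [div_self hne, mul_one] at h
  refine h.congr' ?_
  filter_upwards [hid.eventually_ne one_ne_zero] with q hq
  rw [Sfun, Pi.div_apply, mul_div_mul_comm, show q ^ a / q = q ^ (a - 1) by rw [zpow_sub_one₀ hq, div_eq_mul_inv],
    ← neg_div_neg_eq (q ^ (a - 1) - 1), neg_sub, neg_sub]

theorem prod_Icc_add_div_add_sub_one (i v : ℕ) (hi : 1 ≤ i) :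
    ∏ j ∈ Finset.Icc 1 v, ((i : ℂ) + j) / (i + j - 1) = (i + v) / i := by
  have hi0 : (i : ℂ) ≠ 0 := by exact_mod_cast (by omega : i ≠ 0)
  induction v with
  | zero => simp [hi0]
  | succ v ih =>
    have hiv : (i : ℂ) + v ≠ 0 := by exact_mod_cast (by omega : i + v ≠ 0)
    rw [Finset.prod_Icc_succ_top (by omega), ih]
    push_cast
    rw [← add_assoc, add_sub_cancel_right]
    field_simp

theorem prod_Icc_add_div_eq_choose (n v : ℕ) :
    ∏ i ∈ Finset.Icc 1 n, ((i : ℂ) + v) / i = ((n + v).choose v : ℂ) := by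
  induction n with
  | zero => simp
  | succ n ih =>
    have hn : (n : ℂ) + 1 ≠ 0 := by exact_mod_cast n.succ_ne_zero
    rw [Finset.prod_Icc_succ_top (by omega), ih, ← mul_div_assoc]
    push_cast
    rw [div_eq_iff hn]
    have h := Nat.choose_mul_succ_eq (n + v) v
    rw [show n + v + 1 - v = n + 1 by omega, show n + v + 1 = n + 1 + v by omega] at h
    exact_mod_cast h

/-- Classical limit `q₁ → 1` of the irreducible A₁ qq-character coefficients:
the coefficient `∏_{i=1}^{w−v} ∏_{j=1}^{v} 𝒮(q₁^{1−i−j})` tends to the binomial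
coefficient `C(w, v)`; consequently the irreducible weight-`w` qq-character
degenerates to the `w`-th power `(𝖸_x + 𝖸_{xq₂}^{−1})^w` of the fundamental
q-character. -/
theorem A1_coefficient_limit_q1 (w v : ℕ) (hw : 1 ≤ w) (hv : v ≤ w)
    (q₂ : ℂ) (hq₂ : q₂ ≠ 0) (hq₂1 : q₂ ≠ 1) :
    Tendsto (fun q₁ : ℂ =>
        ∏ i ∈ Finset.Icc 1 (w - v), ∏ j ∈ Finset.Icc 1 v,
          Sfun q₁ q₂ (q₁ ^ (1 - (i : ℤ) - (j : ℤ))))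
      (𝓝[≠] 1) (𝓝 (w.choose v : ℂ)) ∧
    ∀ (K : Type) [CommRing K] (u y : Kˣ),
      ∑ j ∈ Finset.range (w + 1),
          (w.choose j : K) * (u : K) ^ (w - j) * ((y⁻¹ : Kˣ) : K) ^ j
        = ((u : K) + ((y⁻¹ : Kˣ) : K)) ^ w := by
  refine ⟨?_, fun K _ u y => ?_⟩
  · have hlim : ∏ i ∈ Finset.Icc 1 (w - v), ∏ j ∈ Finset.Icc 1 v,
        (((1 - (i : ℤ) - (j : ℤ) - 1 : ℤ) : ℂ) / ((1 - (i : ℤ) - (j : ℤ) : ℤ) : ℂ))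
          = (w.choose v : ℂ) := by
      rw [← congrArg (fun n => (n.choose v : ℂ)) (Nat.sub_add_cancel hv),
        ← prod_Icc_add_div_eq_choose]
      refine Finset.prod_congr rfl fun i hi => ?_
      rw [← prod_Icc_add_div_add_sub_one i v (Finset.mem_Icc.mp hi).1]
      refine Finset.prod_congr rfl fun j _ => ?_
      rw [← neg_div_neg_eq]
      push_cast
      congr 1 <;> ring
    rw [← hlim]
    refine tendsto_finsetProd _ fun i hi => tendsto_finsetProd _ fun j hj => ?_
    rw [Finset.mem_Icc] at hi hj
    exact tendsto_Sfun_zpow q₂ hq₂ hq₂1 _ (by omega)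
  · rw [add_comm (u : K), add_pow]
    exact Finset.sum_congr rfl fun j _ => by ring
end
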